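/- arXiv:1801.03120 — 2 statements merged into one kernel-verified Lean document; each statement's English description precedes it below -/
import Mathlib

section
/- Let q be a real number with q > 1/2 and q ≠ 1, and set a = 1/(2q). Define F̂_q on [0,1) by F̂_q(u) = (1 − q^{1−u})/(1 − q) − q^{−u}·2^{1−u}·𝒯_a(2^{u−1}), where q^t and 2^t denote real powers. Then for every integer n ≥ 1, with {log₂ n} denoting the fractional part of log₂ n: (1/n)·S_q(n) = (q/2)·( (1 − q^{log₂ n})/(1 − q) + q^{log₂ n}·F̂_q({log₂ n}) ). -/
noncomputable section

open MeasureTheory Filter Finset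

/-- Distance from `x` to the nearest integer. -/
def distInt (x : ℝ) : ℝ := |x - round x|

/-- The Takagi–Landsberg function with parameter `a`:
`𝒯_a(x) = ∑_{n≥0} a^n · dist(2^n x, ℤ)`. -/
def takagi (a : ℝ) (x : ℝ) : ℝ := ∑' n : ℕ, a ^ n * distInt (2 ^ n * x)

/-- Weighted sum-of-binary-digits function: for `j = ∑ ω_i 2^i`,
`s_q(j) = ∑ ω_i q^{i+1}`. -/
def sqN (q : ℝ) (j : ℕ) : ℝ := ∑ i ∈ Finset.range j, if j.testBit i then q ^ (i + 1) else 0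

/-- `S_q(n) = ∑_{j<n} s_q(j)`. -/
def Sq (q : ℝ) (n : ℕ) : ℝ := ∑ j ∈ Finset.range n, sqN q j

theorem distInt_eq_abs_sub {x : ℝ} {c : ℤ} (h : |x - c| ≤ 1 / 2) : distInt x = |x - c| := by
  refine le_antisymm (round_le x c) ?_
  unfold distInt
  by_cases hc : round x = c
  · rw [hc]
  have h1 : (1 : ℝ) ≤ |(round x : ℝ) - c| := by
    exact_mod_cast Int.one_le_abs (sub_ne_zero.mpr hc)
  have h2 := abs_sub_le (round x : ℝ) x c
  rw [abs_sub_comm (round x : ℝ) x] at h2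
  linarith

theorem distInt_natCast (n : ℕ) : distInt n = 0 := by
  simp [distInt]

/-- The number of `j < n` with `i`-th binary digit `1`, in terms of the distance function. -/
theorem sum_range_testBit (i n : ℕ) :
    ∑ j ∈ Finset.range n, (if j.testBit i then (1 : ℝ) else 0)
      = n / 2 - 2 ^ i * distInt (n / 2 ^ (i + 1)) := by
  induction n with
  | zero => simp [distInt]
  | succ n ih =>
    rw [Finset.sum_range_succ, ih, Nat.testBit_eq_decide_div_mod_eq]
    have hp : (0 : ℝ) < 2 ^ i := by positivity
    have hdm : (n : ℝ) = 2 ^ i * ((n / 2 ^ i : ℕ) : ℝ) + ((n % 2 ^ i : ℕ) : ℝ) := by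
      exact_mod_cast (Nat.div_add_mod n (2 ^ i)).symm
    have hlt : ((n % 2 ^ i : ℕ) : ℝ) + 1 ≤ 2 ^ i := by
      exact_mod_cast Nat.mod_lt n (by positivity : 0 < 2 ^ i)
    have hs0 : (0 : ℝ) ≤ ((n % 2 ^ i : ℕ) : ℝ) := Nat.cast_nonneg _
    have hb := Nat.div_add_mod (n / 2 ^ i) 2
    push_cast
    rw [pow_succ]
    generalize n % 2 ^ i = s at *
    generalize n / 2 ^ i = b at *
    generalize (2 : ℝ) ^ i = p at *
    rcases Nat.mod_two_eq_zero_or_one b with h | h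
    · have key : ∀ t : ℝ, 0 ≤ t → t ≤ p →
          distInt ((p * b + t) / (p * 2)) = t / (p * 2) := by
        intro t ht htp
        have hbc : (b : ℝ) = 2 * ((b / 2 : ℕ) : ℝ) := by
          rw [h] at hb; exact_mod_cast hb.symm
        have e : (p * b + t) / (p * 2) - (((b / 2 : ℕ) : ℤ) : ℝ) = t / (p * 2) := by
          rw [hbc, Int.cast_natCast]; field_simp; ring
        have e2 : |t / (p * 2)| = t / (p * 2) := abs_of_nonneg (by positivity)
        rw [distInt_eq_abs_sub (c := ((b / 2 : ℕ) : ℤ)), e, e2]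
        rw [e, e2, div_le_iff₀ (by positivity)]
        linarith
      rw [hdm, add_assoc, key _ hs0 (by linarith), key _ (by linarith) hlt]
      simp only [h]
      field_simp
      norm_num
    · have key : ∀ t : ℝ, 0 ≤ t → t ≤ p →
          distInt ((p * b + t) / (p * 2)) = (p - t) / (p * 2) := by
        intro t ht htp
        have hbc : (b : ℝ) = 2 * ((b / 2 : ℕ) : ℝ) + 1 := by
          rw [h] at hb; exact_mod_cast hb.symm
        have e : (p * b + t) / (p * 2) - (((b / 2 + 1 : ℕ) : ℤ) : ℝ) = -((p - t) / (p * 2)) := by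
          rw [hbc, Int.cast_natCast]; push_cast; field_simp; ring
        have e2 : |-((p - t) / (p * 2))| = (p - t) / (p * 2) := by
          rw [abs_neg]
          exact abs_of_nonneg (div_nonneg (by linarith) (by positivity))
        rw [distInt_eq_abs_sub (c := ((b / 2 + 1 : ℕ) : ℤ)), e, e2]
        rw [e, e2, div_le_iff₀ (by positivity)]
        linarith
      rw [hdm, add_assoc, key _ hs0 (by linarith), key _ (by linarith) hlt]
      simp only [h]
      field_simp
      norm_num
      ring

theorem sqN_eq_sum_range (q : ℝ) {j M : ℕ} (h : j < 2 ^ M) :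
    sqN q j = ∑ i ∈ Finset.range M, if j.testBit i then q ^ (i + 1) else 0 := by
  have extend : ∀ {N : ℕ}, j < 2 ^ N →
      ∑ i ∈ Finset.range N, (if j.testBit i then q ^ (i + 1) else 0)
        = ∑ i ∈ Finset.range (max j M), if j.testBit i then q ^ (i + 1) else 0 := by
    intro N hN
    have vanish : ∀ i, N ≤ i → (if j.testBit i then q ^ (i + 1) else 0) = 0 := by
      intro i hi
      rw [Nat.testBit_lt_two_pow (hN.trans_le (Nat.pow_le_pow_right two_pos hi))]
      simp
    rcases le_total N (max j M) with hle | hle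
    · exact Finset.sum_subset (Finset.range_mono hle)
        fun i _ hi => vanish i (by simpa using hi)
    · symm
      refine Finset.sum_subset (Finset.range_mono hle) fun i _ hi => ?_
      have hi' : max j M ≤ i := by simpa using hi
      have hj : j < 2 ^ i := Nat.lt_two_pow_self.trans_le
        (Nat.pow_le_pow_right two_pos ((le_max_left j M).trans hi'))
      rw [Nat.testBit_lt_two_pow hj]
      simp
  exact (extend Nat.lt_two_pow_self).trans (extend h).symm

theorem Sq_eq_sum_distInt (q : ℝ) {n M : ℕ} (h : n ≤ 2 ^ M) :
    Sq q n = ∑ i ∈ Finset.range M,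
      q ^ (i + 1) * (n / 2 - 2 ^ i * distInt (n / 2 ^ (i + 1))) := by
  unfold Sq
  rw [Finset.sum_congr rfl fun j hj =>
    sqN_eq_sum_range q ((Finset.mem_range.mp hj).trans_le h), Finset.sum_comm]
  refine Finset.sum_congr rfl fun i _ => ?_
  rw [← sum_range_testBit, Finset.mul_sum]
  simp

theorem takagi_dyadic (a : ℝ) (n M : ℕ) :
    takagi a (n / 2 ^ M)
      = ∑ k ∈ Finset.range M, a ^ k * distInt (n / 2 ^ (M - k)) := by
  unfold takagi
  rw [tsum_eq_sum (s := Finset.range M)]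
  · refine Finset.sum_congr rfl fun k hk => ?_
    congr 2
    rw [← Nat.add_sub_of_le (Finset.mem_range.mp hk).le, pow_add, Nat.add_sub_cancel_left]
    field_simp
  · intro k hk
    have hk' : M ≤ k := by simpa using hk
    have : (2 : ℝ) ^ k * (n / 2 ^ M) = ((2 ^ (k - M) * n : ℕ) : ℝ) := by
      rw [← Nat.add_sub_of_le hk', pow_add, Nat.add_sub_cancel_left]
      push_cast
      field_simp
    rw [this, distInt_natCast, mul_zero]

theorem Sq_eq_takagi {q : ℝ} (hq : q ≠ 0) {n m : ℕ} (h : n ≤ 2 ^ (m + 1)) :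
    Sq q n = q / 2 * (n * ∑ i ∈ Finset.range (m + 1), q ^ i
      - 2 * (2 * q) ^ m * takagi (1 / (2 * q)) (n / 2 ^ (m + 1))) := by
  have hT : (2 * q) ^ m * takagi (1 / (2 * q)) (n / 2 ^ (m + 1))
      = ∑ i ∈ Finset.range (m + 1), (2 * q) ^ i * distInt (n / 2 ^ (i + 1)) := by
    rw [takagi_dyadic, Finset.mul_sum, ← Finset.sum_range_reflect _ (m + 1)]
    refine Finset.sum_congr rfl fun i hi => ?_
    obtain ⟨k, rfl⟩ := Nat.exists_eq_add_of_le (Nat.lt_succ_iff.mp (Finset.mem_range.mp hi))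
    have e1 : i + k + 1 - 1 - i = k := by omega
    have e2 : i + k + 1 - k = i + 1 := by omega
    rw [e1, e2, ← mul_assoc, pow_add, mul_assoc ((2 * q) ^ i), ← mul_pow,
      mul_one_div_cancel (mul_ne_zero two_ne_zero hq), one_pow, mul_one]
  rw [Sq_eq_sum_distInt q h, mul_assoc 2, hT, Finset.mul_sum, Finset.mul_sum,
    ← Finset.sum_sub_distrib, Finset.mul_sum]
  refine Finset.sum_congr rfl fun i _ => ?_
  rw [mul_pow, pow_succ q]
  ring

open Real in
theorem trollope_delange_logb (q : ℝ) (hq : 1 / 2 < q) (hq1 : q ≠ 1) (a : ℝ)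
    (ha : a = 1 / (2 * q))
    (Fhat : ℝ → ℝ)
    (hF : ∀ u ∈ Set.Ico (0:ℝ) 1,
      Fhat u = (1 - q ^ (1 - u)) / (1 - q) - q ^ (-u) * (2:ℝ) ^ (1 - u) * takagi a ((2:ℝ) ^ (u - 1)))
    (n : ℕ) (hn : 1 ≤ n) :
    (1 / (n : ℝ)) * Sq q n
      = (q / 2) * ((1 - q ^ Real.logb 2 n) / (1 - q)
          + q ^ Real.logb 2 n * Fhat (Int.fract (Real.logb 2 n))) := by
  have hq0 : 0 < q := by linarith
  have hn0 : (0 : ℝ) < n := by exact_mod_cast hn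
  set u := Int.fract (Real.logb 2 n) with hu
  obtain ⟨m, hm⟩ : ∃ m : ℕ, ⌊Real.logb 2 n⌋ = m :=
    Int.eq_ofNat_of_zero_le
      (Int.floor_nonneg.mpr (Real.logb_nonneg one_lt_two (by exact_mod_cast hn)))
  have hL : Real.logb 2 n = m + u := by
    have := Int.floor_add_fract (Real.logb 2 n)
    rw [hm] at this
    exact_mod_cast this.symm
  have hu0 : 0 ≤ u := Int.fract_nonneg _
  have hu1 : u < 1 := Int.fract_lt_one _
  have hn2 : (n : ℝ) = 2 ^ m * (2 : ℝ) ^ u := by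
    rw [← Real.rpow_natCast, ← Real.rpow_add two_pos, ← hL,
      Real.rpow_logb two_pos (by norm_num) hn0]
  have hlt : n ≤ 2 ^ (m + 1) := by
    have h2 : (2 : ℝ) ^ u ≤ 2 := by
      simpa using Real.rpow_le_rpow_of_exponent_le one_le_two hu1.le
    have : (n : ℝ) ≤ 2 ^ (m + 1) := by
      rw [hn2, pow_succ]; gcongr
    exact_mod_cast this
  have h2u : (0 : ℝ) < (2 : ℝ) ^ u := Real.rpow_pos_of_pos two_pos u
  have hqu : 0 < q ^ u := Real.rpow_pos_of_pos hq0 u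
  have harg : (2 : ℝ) ^ (u - 1) = n / 2 ^ (m + 1) := by
    rw [Real.rpow_sub_one two_ne_zero, hn2, pow_succ]
    field_simp
  rw [hF u ⟨hu0, hu1⟩, harg, hL, Sq_eq_takagi hq0.ne' hlt, ← ha, geom_sum_eq hq1,
    Real.rpow_add hq0, Real.rpow_natCast, Real.rpow_neg hq0.le, Real.rpow_sub hq0,
    Real.rpow_sub two_pos, Real.rpow_one, Real.rpow_one]
  generalize takagi a (n / 2 ^ (m + 1)) = T
  rw [hn2]
  have h1 : q - 1 ≠ 0 := sub_ne_zero.mpr hq1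
  have h1' : 1 - q ≠ 0 := sub_ne_zero.mpr hq1.symm
  have hinv : (q ^ (m + 1) - 1) / (q - 1) = (1 - q ^ (m + 1)) / (1 - q) := by
    rw [← neg_sub 1 (q ^ (m + 1)), ← neg_sub 1 q, neg_div_neg_eq]
  rw [hinv, mul_pow, pow_succ]
  field_simp
  ring

end
end

section
/- Let q be a nonzero real number. Then for every integer n ≥ 1: G_q(n + p_n) = (1/(2q))·G_q(n) + ((p_n − n)/(4p_n))·(3 − 2q). -/
noncomputable section

open MeasureTheory Filter Finset

/-- `G_q(n) = (1/(p_n q^{k_n})) (S_q(n) - (n/p_n) S_q(p_n))` where `k_n = ⌊log₂ n⌋`,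
`p_n = 2^{k_n}`. -/
def Gq (q : ℝ) (n : ℕ) : ℝ :=
  (1 / ((2 ^ Nat.log 2 n : ℝ) * q ^ Nat.log 2 n)) *
    (Sq q n - ((n : ℝ) / (2 ^ Nat.log 2 n : ℝ)) * Sq q (2 ^ Nat.log 2 n))

lemma sqN_eq_sum_range_of_lt_two_pow (q : ℝ) {j N : ℕ} (hj : j < 2 ^ N) :
    sqN q j = ∑ i ∈ Finset.range N, if j.testBit i then q ^ (i + 1) else 0 := by
  have extend : ∀ M, j < 2 ^ M →
      ∑ i ∈ Finset.range M, (if j.testBit i then q ^ (i + 1) else 0) =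
        ∑ i ∈ Finset.range (max j N), if j.testBit i then q ^ (i + 1) else 0 := by
    intro M hM
    rcases le_total M (max j N) with h | h
    · refine (Finset.eventually_constant_sum (fun i hi => ?_) h).symm
      simp [Nat.testBit_lt_two_pow (hM.trans_le (Nat.pow_le_pow_right two_pos hi))]
    · have hj' : j < 2 ^ max j N :=
        Nat.lt_two_pow_self.trans_le (Nat.pow_le_pow_right two_pos (le_max_left _ _))
      refine Finset.eventually_constant_sum (fun i hi => ?_) h
      simp [Nat.testBit_lt_two_pow (hj'.trans_le (Nat.pow_le_pow_right two_pos hi))]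
  rw [extend N hj, ← extend j Nat.lt_two_pow_self, sqN]

lemma sqN_two_pow_add (q : ℝ) {k m : ℕ} (hm : m < 2 ^ k) :
    sqN q (2 ^ k + m) = q ^ (k + 1) + sqN q m := by
  rw [sqN_eq_sum_range_of_lt_two_pow q (N := k + 1) (by rw [pow_succ]; omega),
    sqN_eq_sum_range_of_lt_two_pow q hm, Finset.sum_range_succ, add_comm,
    Nat.testBit_two_pow_add_eq, Nat.testBit_lt_two_pow hm]
  congr 1
  refine Finset.sum_congr rfl fun i hi => ?_
  rw [Nat.testBit_two_pow_add_gt (Finset.mem_range.mp hi)]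

lemma Sq_two_pow_add (q : ℝ) {k m : ℕ} (hm : m ≤ 2 ^ k) :
    Sq q (2 ^ k + m) = Sq q (2 ^ k) + (m * q ^ (k + 1) + Sq q m) := by
  have h : ∀ j ∈ Finset.range m, sqN q (2 ^ k + j) = q ^ (k + 1) + sqN q j := fun j hj =>
    sqN_two_pow_add q ((Finset.mem_range.mp hj).trans_le hm)
  simp only [Sq]
  rw [Finset.sum_range_add, Finset.sum_congr rfl h, Finset.sum_add_distrib]
  simp

theorem Gq_add_pow (q : ℝ) (hq : q ≠ 0) (n : ℕ) (hn : 1 ≤ n)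
    (p : ℕ) (hp : p = 2 ^ Nat.log 2 n) :
    Gq q (n + p) = (1 / (2 * q)) * Gq q n + (((p : ℝ) - (n : ℝ)) / (4 * (p : ℝ))) * (3 - 2 * q) := by
  obtain ⟨k, hk⟩ : ∃ k, k = Nat.log 2 n := ⟨_, rfl⟩
  rw [← hk] at hp
  have hle : 2 ^ k ≤ n := hk ▸ Nat.pow_log_le_self 2 (by omega)
  have hlt : n < 2 ^ (k + 1) := hk ▸ Nat.lt_pow_succ_log_self one_lt_two n
  obtain ⟨m, rfl⟩ := Nat.exists_eq_add_of_le hle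
  have hm : m < 2 ^ k := by rw [pow_succ] at hlt; omega
  have hsum : 2 ^ k + m + p = 2 ^ (k + 1) + m := by rw [hp, pow_succ]; ring
  have hlog : Nat.log 2 (2 ^ (k + 1) + m) = k + 1 :=
    Nat.log_eq_of_pow_le_of_lt_pow (by omega) (by simp only [pow_succ] at *; omega)
  have hdouble : Sq q (2 ^ (k + 1)) = Sq q (2 ^ k) + (2 ^ k * q ^ (k + 1) + Sq q (2 ^ k)) := by
    have h := Sq_two_pow_add q (le_refl (2 ^ k))
    rw [← two_mul, ← pow_succ'] at h
    exact_mod_cast h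
  rw [hsum]
  unfold Gq
  rw [hlog, ← hk, Sq_two_pow_add q (show m ≤ 2 ^ (k + 1) by omega), Sq_two_pow_add q hm.le,
    hdouble, hp]
  push_cast
  have h2 : (2 : ℝ) ^ k ≠ 0 := by positivity
  have hqk : q ^ k ≠ 0 := pow_ne_zero k hq
  simp only [pow_succ]
  field_simp
  ring

end
end
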